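/- arXiv:2312.05606 — 5 statements merged into one kernel-verified Lean document; each statement's English description precedes it below -/
import Mathlib

section
/- Let f : ℝ → ℝ be continuous and let F : ℝ → ℝ be an antiderivative of f (F′ = f). Let s ∈ ℝ, u₋, u₊ ∈ ℝ, and let φ : ℝ → ℝ be twice differentiable and satisfy the traveling wave equation φ″(ζ) + s φ′(ζ) + f(φ(ζ)) = 0 for all ζ ∈ ℝ, together with φ(ζ) → u₊ as ζ → +∞, φ(ζ) → u₋ as ζ → −∞, φ′(ζ) → 0 as ζ → ±∞, and (φ′)² integrable over ℝ. Then s · ∫_ℝ (φ′(ζ))² dζ = −∫_{u₋}^{u₊} f(w) dw = F(u₋) − F(u₊). In particular, if ∫_ℝ (φ′)² ≠ 0, the wave speed is s = −(∫_{u₋}^{u₊} f(w) dw) / (∫_ℝ (φ′)² dζ). -/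
open MeasureTheory Filter

/-- Wave-speed formula for traveling fronts of `∂_t u = ∂_x² u + f(u)`: if the
profile `φ` satisfies `φ'' + sφ' + f(φ) = 0`, connects `um = u₋` (at `-∞`) to
`up = u₊` (at `+∞`), its derivative vanishes at `±∞`, and `(φ')² ∈ L¹(ℝ)`, then
`s ∫ (φ')² = −∫_{u₋}^{u₊} f = F(u₋) − F(u₊)`; in particular
`s = −(∫_{u₋}^{u₊} f)/(∫ (φ')²)` when `∫ (φ')² ≠ 0`. -/
theorem traveling_wave_speed_formula
    (f F : ℝ → ℝ) (hf : Continuous f) (hF : ∀ x, HasDerivAt F (f x) x)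
    (s um up : ℝ) (φ φ' φ'' : ℝ → ℝ)
    (hφ : ∀ ζ, HasDerivAt φ (φ' ζ) ζ)
    (hφ' : ∀ ζ, HasDerivAt φ' (φ'' ζ) ζ)
    (hODE : ∀ ζ, φ'' ζ + s * φ' ζ + f (φ ζ) = 0)
    (hlimp : Tendsto φ atTop (nhds up)) (hlimm : Tendsto φ atBot (nhds um))
    (hdlimp : Tendsto φ' atTop (nhds 0)) (hdlimm : Tendsto φ' atBot (nhds 0))
    (hint : Integrable (fun ζ => (φ' ζ) ^ 2)) :
    s * (∫ ζ : ℝ, (φ' ζ) ^ 2) = -(∫ w in um..up, f w) ∧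
    -(∫ w in um..up, f w) = F um - F up ∧
    ((∫ ζ : ℝ, (φ' ζ) ^ 2) ≠ 0 →
      s = -(∫ w in um..up, f w) / (∫ ζ : ℝ, (φ' ζ) ^ 2)) := by
  have hF_int : ∫ w in um..up, f w = F up - F um :=
    intervalIntegral.integral_eq_sub_of_hasDerivAt (fun x _ => hF x)
      (hf.intervalIntegrable um up)
  have henergy : ∀ ζ, HasDerivAt (fun ζ => -((φ' ζ) ^ 2 / 2 + F (φ ζ)))
      (s * (φ' ζ) ^ 2) ζ := by
    intro ζ
    refine ((((hφ' ζ).pow 2).div_const 2).add ((hF (φ ζ)).comp ζ (hφ ζ))).neg.congr_deriv ?_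
    push_cast
    linear_combination (-φ' ζ) * hODE ζ
  have hlim : ∀ {l : Filter ℝ} {u : ℝ}, Tendsto φ l (nhds u) → Tendsto φ' l (nhds 0) →
      Tendsto (fun ζ => -((φ' ζ) ^ 2 / 2 + F (φ ζ))) l (nhds (-F u)) := by
    intro l u hu h0
    simpa using (((h0.pow 2).div_const 2).add ((hF u).continuousAt.tendsto.comp hu)).neg
  have hmain : s * (∫ ζ : ℝ, (φ' ζ) ^ 2) = -(∫ w in um..up, f w) := by
    rw [← integral_const_mul, integral_of_hasDerivAt_of_tendsto henergy (hint.const_mul s)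
      (hlim hlimm hdlimm) (hlim hlimp hdlimp), hF_int]
    ring
  exact ⟨hmain, by rw [hF_int]; ring, fun h => (eq_div_iff h).2 hmain⟩
end

section
/- Let α ∈ (0,1), s < 0, ζ ∈ ℝ, and let u : ℝ → ℝ be continuously differentiable such that δ ↦ u′(ζ − δ) δ^{−α} is absolutely integrable on (0,∞). For t > 0 define C(t) = (1/Γ(1−α)) ∫_0^t (t−σ)^{−α} · (−s) · u′(ζ + s(t−σ)) dσ, which is the Caputo fractional derivative of order α at time t of σ ↦ u(x − sσ) evaluated with x = ζ + st. Then: (a) for every t > 0, C(t) = ((−s)^α/Γ(1−α)) ∫_0^{−st} u′(ζ − δ) δ^{−α} dδ; and (b) C(t) → ((−s)^α/Γ(1−α)) ∫_0^∞ u′(ζ − δ) δ^{−α} dδ as t → +∞. -/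
open MeasureTheory Filter

/-- The Caputo fractional derivative of a traveling wave ansatz `u(x - sσ)` (with
`s < 0`, evaluated at `x = ζ + st`) equals
`((-s)^α/Γ(1-α)) ∫_0^{-st} u'(ζ-δ) δ^{-α} dδ`, and in the long-term memory limit
`t → ∞` it converges to `((-s)^α/Γ(1-α)) ∫_0^∞ u'(ζ-δ) δ^{-α} dδ`. -/
theorem caputo_traveling_wave_memory_limit
    (α : ℝ) (hα : α ∈ Set.Ioo (0:ℝ) 1) (s : ℝ) (hs : s < 0) (ζ : ℝ)
    (u u' : ℝ → ℝ) (hu : ∀ x, HasDerivAt u (u' x) x) (hu' : Continuous u')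
    (hint : IntegrableOn (fun δ => u' (ζ - δ) * δ ^ (-α)) (Set.Ioi (0:ℝ)))
    (C : ℝ → ℝ)
    (hC : ∀ t, C t = (1 / Real.Gamma (1 - α)) *
        ∫ σ in (0:ℝ)..t, (t - σ) ^ (-α) * ((-s) * u' (ζ + s * (t - σ)))) :
    (∀ t : ℝ, 0 < t →
        C t = ((-s) ^ α / Real.Gamma (1 - α)) *
          ∫ δ in (0:ℝ)..(-s * t), u' (ζ - δ) * δ ^ (-α)) ∧
    Tendsto C atTop
      (nhds (((-s) ^ α / Real.Gamma (1 - α)) *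
        ∫ δ in Set.Ioi (0:ℝ), u' (ζ - δ) * δ ^ (-α))) := by
  have hc : 0 < -s := neg_pos.mpr hs
  have key : ∀ t : ℝ, 0 < t →
      C t = ((-s) ^ α / Real.Gamma (1 - α)) *
        ∫ δ in (0:ℝ)..(-s * t), u' (ζ - δ) * δ ^ (-α) := by
    intro t ht
    have scaled : ∫ x in (0:ℝ)..t, x ^ (-α) * ((-s) * u' (ζ + s * x)) =
        ∫ x in (0:ℝ)..t, (-s) ^ α * (-s) * (u' (ζ - -s * x) * (-s * x) ^ (-α)) := by
      refine intervalIntegral.integral_congr fun x hx => ?_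
      rw [Set.uIcc_of_le ht.le] at hx
      have hcancel : (-s) ^ α * (-s) ^ (-α) = 1 := by
        rw [← Real.rpow_add hc, add_neg_cancel, Real.rpow_zero]
      have harg : ζ - -s * x = ζ + s * x := by ring
      simp only [Real.mul_rpow hc.le hx.1, harg]
      linear_combination (-(x ^ (-α) * (-s) * u' (ζ + s * x))) * hcancel
    rw [hC, intervalIntegral.integral_comp_sub_left
      (fun x => x ^ (-α) * ((-s) * u' (ζ + s * x))) t, sub_self, sub_zero, scaled,
      intervalIntegral.integral_const_mul, mul_assoc ((-s) ^ α),
      intervalIntegral.mul_integral_comp_mul_left (f := fun δ => u' (ζ - δ) * δ ^ (-α)), mul_zero]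
    ring
  refine ⟨key, ?_⟩
  refine Tendsto.congr' ((eventually_gt_atTop 0).mono fun t ht => (key t ht).symm) ?_
  exact (intervalIntegral_tendsto_integral_Ioi 0 hint
    (tendsto_id.const_mul_atTop hc)).const_mul _
end

section
/- Let α ∈ (0,1) and λ ∈ ℝ, and define u(t) = E_α(−λ t^α) = ∑_{n=0}^∞ (−λ t^α)^n / Γ(1+nα) for t ≥ 0. Then u is differentiable on (0,∞), and for every t > 0 the integral (1/Γ(1−α)) ∫_0^t (t−s)^{−α} u′(s) ds converges absolutely and equals −λ u(t). That is, u solves the homogeneous Caputo fractional differential equation 𝔇̃^α_{0,t} u + λ u = 0 with u(0) = 1. -/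
open MeasureTheory

/-- A crude lower bound for the Gamma function: it eventually dominates every exponential. -/
theorem exp_neg_mul_rpow_le_Gamma_one_add {M x : ℝ} (hM : 0 < M) (hx : 0 ≤ x) :
    Real.exp (-M) * M ^ x ≤ Real.Gamma (1 + x) := by
  have hint := Real.GammaIntegral_convergent (s := 1 + x) (by linarith)
  have hexp : ∫ t in Set.Ioi M, Real.exp (-t) * M ^ x = Real.exp (-M) * M ^ x := by
    rw [integral_mul_const, integral_exp_neg_Ioi]
  have hsub : Set.Ioi M ⊆ Set.Ioi 0 := Set.Ioi_subset_Ioi hM.le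
  rw [Real.Gamma_eq_integral (by linarith), ← hexp]
  calc ∫ t in Set.Ioi M, Real.exp (-t) * M ^ x
      ≤ ∫ t in Set.Ioi M, Real.exp (-t) * t ^ (1 + x - 1) := by
        refine setIntegral_mono_on ((integrableOn_exp_neg_Ioi M).mul_const _)
          (hint.mono_set hsub) measurableSet_Ioi fun t ht => ?_
        rw [add_sub_cancel_left]
        gcongr
        exact (Set.mem_Ioi.1 ht).le
    _ ≤ ∫ t in Set.Ioi 0, Real.exp (-t) * t ^ (1 + x - 1) := by
        refine setIntegral_mono_set hint ?_ hsub.eventuallyLE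
        filter_upwards [ae_restrict_mem measurableSet_Ioi] with t ht
        have := Set.mem_Ioi.1 ht
        simp only [Pi.zero_apply]
        positivity

/-- The Mittag-Leffler series converges everywhere. -/
theorem summable_pow_div_Gamma {α : ℝ} (hα : 0 < α) {R : ℝ} (hR : 0 ≤ R) :
    Summable fun n : ℕ => R ^ n / Real.Gamma (1 + n * α) := by
  set M : ℝ := (R + 1) ^ (1 / α) with hM
  have hM0 : 0 < M := by positivity
  have hMα : M ^ α = R + 1 := by
    rw [hM, ← Real.rpow_mul (by positivity), one_div_mul_cancel hα.ne', Real.rpow_one]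
  have hgeom : Summable fun n : ℕ => Real.exp M * (R / (R + 1)) ^ n :=
    (summable_geometric_of_lt_one (by positivity)
      ((div_lt_one (by positivity)).2 (by linarith))).mul_left _
  refine Summable.of_nonneg_of_le (fun n => ?_) (fun n => ?_) hgeom
  · have := Real.Gamma_pos_of_pos (show 0 < 1 + n * α by positivity)
    positivity
  · have h := exp_neg_mul_rpow_le_Gamma_one_add hM0 (show 0 ≤ n * α by positivity)
    rw [mul_comm (n : ℝ) α, Real.rpow_mul hM0.le, hMα, Real.rpow_natCast, mul_comm α] at h
    calc R ^ n / Real.Gamma (1 + n * α) ≤ R ^ n / (Real.exp (-M) * (R + 1) ^ n) := by gcongr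
      _ = Real.exp M * (R / (R + 1)) ^ n := by
        rw [Real.exp_neg, div_pow]
        field_simp

theorem summable_nat_mul_pow_div_Gamma {α : ℝ} (hα : 0 < α) {R : ℝ} (hR : 0 ≤ R) :
    Summable fun n : ℕ => n * (R ^ n / Real.Gamma (1 + n * α)) := by
  refine Summable.of_nonneg_of_le (fun n => ?_) (fun n => ?_)
    (summable_pow_div_Gamma hα (R := 2 * R) (by positivity))
  · have := Real.Gamma_pos_of_pos (show 0 < 1 + n * α by positivity)
    positivity
  · have := Real.Gamma_pos_of_pos (show 0 < 1 + n * α by positivity)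
    rw [mul_pow, mul_div_assoc]
    gcongr
    exact_mod_cast Nat.lt_two_pow_self.le

/-- The real Beta integral on `[0, t]`. -/
theorem integral_rpow_mul_sub_rpow {a b t : ℝ} (ha : 0 < a) (hb : 0 < b) (ht : 0 < t) :
    ∫ s in (0 : ℝ)..t, s ^ (a - 1) * (t - s) ^ (b - 1) =
      t ^ (a + b - 1) * (Real.Gamma a * Real.Gamma b / Real.Gamma (a + b)) := by
  have h := Complex.betaIntegral_scaled a b ht
  rw [Complex.betaIntegral_eq_Gamma_mul_div _ _ (by simpa) (by simpa)] at h
  apply Complex.ofReal_injective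
  rw [← intervalIntegral.integral_ofReal]
  push_cast [Complex.ofReal_cpow ht.le, ← Complex.Gamma_ofReal] at h ⊢
  rw [← h]
  refine intervalIntegral.integral_congr fun s hs => ?_
  rw [Set.uIcc_of_le ht.le] at hs
  simp only [Complex.ofReal_cpow hs.1, Complex.ofReal_cpow (sub_nonneg.2 hs.2)]
  push_cast
  rfl

theorem intervalIntegrable_rpow_mul_sub_rpow {a b t : ℝ} (ha : 0 < a) (hb : 0 < b) (ht : 0 < t) :
    IntervalIntegrable (fun s => s ^ (a - 1) * (t - s) ^ (b - 1)) volume 0 t := by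
  by_contra h
  have h0 := intervalIntegral.integral_undef h
  rw [integral_rpow_mul_sub_rpow ha hb ht] at h0
  have := Real.Gamma_pos_of_pos ha
  have := Real.Gamma_pos_of_pos hb
  have := Real.Gamma_pos_of_pos (add_pos ha hb)
  exact absurd h0 (by positivity)

/-- Termwise differentiation of the Mittag-Leffler series in `t`. -/
theorem hasDerivAt_mittagLeffler_rpow {α : ℝ} (hα : 0 < α) (z : ℝ) {t : ℝ} (ht : 0 < t) :
    ∃ v, HasDerivAt (fun t : ℝ => ∑' n : ℕ, (z * t ^ α) ^ n / Real.Gamma (1 + n * α)) v t ∧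
      HasSum (fun n : ℕ => z ^ (n + 1) / Real.Gamma ((n + 1) * α) * t ^ ((n + 1) * α - 1)) v := by
  let g' : ℕ → ℝ → ℝ := fun n y => z ^ n / Real.Gamma (1 + n * α) * (n * α * y ^ (n * α - 1))
  let B : ℕ → ℝ := fun n =>
    (α * (2 / t)) * (n * ((|z| * (2 * t) ^ α) ^ n / Real.Gamma (1 + n * α)))
  have hB : Summable B := (summable_nat_mul_pow_div_Gamma hα (by positivity)).mul_left _
  have hpow : ∀ (n : ℕ) {y : ℝ}, 0 < y → (y ^ α) ^ n = y ^ (n * α) := fun n y hy => by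
    rw [← Real.rpow_natCast, ← Real.rpow_mul hy.le, mul_comm]
  have hmem : t ∈ Set.Ioo (t / 2) (2 * t) := ⟨by linarith, by linarith⟩
  have hbound : ∀ n : ℕ, ∀ y ∈ Set.Ioo (t / 2) (2 * t), ‖g' n y‖ ≤ B n := by
    intro n y hy
    have hy0 : 0 < y := by linarith [hy.1]
    have hG := Real.Gamma_pos_of_pos (show 0 < 1 + n * α by positivity)
    have e : ‖g' n y‖ = α * y⁻¹ * (n * ((|z| * y ^ α) ^ n / Real.Gamma (1 + n * α))) := by
      simp only [g']
      rw [Real.rpow_sub_one hy0.ne', mul_pow, hpow n hy0, norm_mul, norm_div, norm_pow,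
        Real.norm_eq_abs, Real.norm_of_nonneg hG.le, Real.norm_of_nonneg (by positivity)]
      field_simp
    rw [e]
    have hinv : y⁻¹ ≤ 2 / t := by
      rw [← inv_div]
      exact inv_anti₀ (by positivity) hy.1.le
    have := hy.2.le
    simp only [B]
    gcongr
  have hder : ∀ n : ℕ, ∀ y ∈ Set.Ioo (t / 2) (2 * t),
      HasDerivAt (fun t : ℝ => (z * t ^ α) ^ n / Real.Gamma (1 + n * α)) (g' n y) y := by
    intro n y hy
    have hy0 : 0 < y := by linarith [hy.1]
    refine ((Real.hasDerivAt_rpow_const (p := n * α) (Or.inl hy0.ne')).const_mul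
      (z ^ n / Real.Gamma (1 + n * α))).congr_of_eventuallyEq ?_
    filter_upwards [lt_mem_nhds hy0] with x hx
    rw [mul_pow, hpow n hx]
    ring
  have hsum0 : Summable fun n : ℕ => (z * t ^ α) ^ n / Real.Gamma (1 + n * α) := by
    refine .of_norm_bounded (summable_pow_div_Gamma hα (abs_nonneg (z * t ^ α))) fun n => ?_
    have hG := Real.Gamma_pos_of_pos (show 0 < 1 + n * α by positivity)
    rw [norm_div, norm_pow, Real.norm_eq_abs, Real.norm_of_nonneg hG.le]
  refine ⟨_, hasDerivAt_tsum_of_isPreconnected hB isOpen_Ioo isPreconnected_Ioo hder hbound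
    hmem hsum0 hmem, ?_⟩
  have hs : HasSum (fun n => g' n t) (∑' n, g' n t) :=
    (Summable.of_norm_bounded hB fun n => hbound n t hmem).hasSum
  rw [← hasSum_nat_add_iff' 1] at hs
  convert! hs using 1
  · ext n
    simp only [g']
    push_cast
    have hn : (0 : ℝ) < (n + 1) * α := by positivity
    have hG := Real.Gamma_pos_of_pos hn
    rw [add_comm (1 : ℝ), Real.Gamma_add_one hn.ne']
    field_simp
  · simp [g']

/-- The Mittag-Leffler function `u(t) = E_α(-λ t^α)` solves the homogeneous Caputo
fractional differential equation `𝔇̃^α u + λ u = 0` with `u(0) = 1`: `u` is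
differentiable on `(0,∞)` and for every `t > 0` the Caputo integral converges
absolutely and equals `-λ u(t)`. -/
theorem mittagLeffler_solves_caputo_ode
    (α lam : ℝ) (hα : α ∈ Set.Ioo (0:ℝ) 1)
    (u : ℝ → ℝ)
    (hu : ∀ t, u t = ∑' n : ℕ, (-lam * t ^ α) ^ n / Real.Gamma (1 + (n : ℝ) * α)) :
    (∀ t : ℝ, 0 < t → DifferentiableAt ℝ u t) ∧
    (∀ t : ℝ, 0 < t →
      IntegrableOn (fun s => (t - s) ^ (-α) * deriv u s) (Set.Ioc 0 t) ∧
      (1 / Real.Gamma (1 - α)) * (∫ s in (0:ℝ)..t, (t - s) ^ (-α) * deriv u s)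
        = -lam * u t) ∧
    u 0 = 1 := by
  obtain ⟨hα0, hα1⟩ := hα
  obtain rfl : u = fun t => ∑' n : ℕ, (-lam * t ^ α) ^ n / Real.Gamma (1 + (n : ℝ) * α) :=
    funext hu
  clear hu
  set u : ℝ → ℝ := fun t => ∑' n : ℕ, (-lam * t ^ α) ^ n / Real.Gamma (1 + (n : ℝ) * α) with hu
  let d : ℕ → ℝ := fun n => (-lam) ^ (n + 1) / Real.Gamma ((n + 1) * α)
  have hderiv : ∀ s : ℝ, 0 < s → DifferentiableAt ℝ u s ∧
      HasSum (fun n : ℕ => d n * s ^ ((n + 1) * α - 1)) (deriv u s) := fun s hs => by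
    obtain ⟨v, hv, hsum⟩ := hasDerivAt_mittagLeffler_rpow hα0 (-lam) hs
    refine ⟨hv.differentiableAt, ?_⟩
    rw [hv.deriv]
    exact hsum
  refine ⟨fun t ht => (hderiv t ht).1, fun t ht => ?_, ?_⟩
  · let k : ℝ → ℝ := fun s => s ^ (α - 1) * (t - s) ^ (1 - α - 1)
    have hk : IntervalIntegrable k volume 0 t :=
      intervalIntegrable_rpow_mul_sub_rpow hα0 (by linarith) ht
    let C : ℕ → ℝ := fun n => |d n| * t ^ (n * α)
    have hC : Summable C := by
      refine (((hderiv t ht).2.summable.abs).mul_right (t ^ (1 - α))).congr fun n => ?_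
      rw [abs_mul, abs_of_nonneg (Real.rpow_nonneg ht.le _), mul_assoc, ← Real.rpow_add ht]
      simp only [C]
      ring_nf
    have hbound : ∀ n : ℕ, ∀ s ∈ Set.Ioc 0 t,
        ‖(t - s) ^ (-α) * (d n * s ^ ((n + 1) * α - 1))‖ ≤ C n * k s := by
      rintro n s ⟨hs0, hst⟩
      have hts : 0 ≤ t - s := sub_nonneg.2 hst
      have e : ((n : ℝ) + 1) * α - 1 = n * α + (α - 1) := by ring
      rw [e, Real.rpow_add hs0, norm_mul, norm_mul, norm_mul, Real.norm_eq_abs (d n),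
        Real.norm_of_nonneg (Real.rpow_nonneg hts _),
        Real.norm_of_nonneg (Real.rpow_nonneg hs0.le _),
        Real.norm_of_nonneg (Real.rpow_nonneg hs0.le _)]
      calc _ = |d n| * s ^ (n * α) * k s := by
            simp only [k]
            rw [show 1 - α - 1 = -α by ring]
            ring
        _ ≤ C n * k s := by
          simp only [C, k]
          gcongr
    have hlim : ∀ s ∈ Set.Ioc 0 t,
        HasSum (fun n : ℕ => (t - s) ^ (-α) * (d n * s ^ ((n + 1) * α - 1)))
          ((t - s) ^ (-α) * deriv u s) :=
      fun s hs => (hderiv s hs.1).2.mul_left _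
    have hbound_int : IntervalIntegrable (fun s => ∑' n, C n * k s) volume 0 t := by
      simp_rw [tsum_mul_right]
      exact hk.const_mul _
    refine ⟨?_, ?_⟩
    · refine Integrable.mono' ((intervalIntegrable_iff_integrableOn_Ioc_of_le ht.le).1 hbound_int)
        ?_ ?_
      · exact (((measurable_const.sub measurable_id).pow_const _).mul
          (measurable_deriv u)).aestronglyMeasurable
      · filter_upwards [ae_restrict_mem measurableSet_Ioc] with s hs
        rw [← (hlim s hs).tsum_eq]
        exact tsum_of_norm_bounded (hC.mul_right (k s)).hasSum fun n => hbound n s hs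
    · have hIoc : Set.uIoc 0 t = Set.Ioc 0 t := Set.uIoc_of_le ht.le
      have hint := intervalIntegral.hasSum_integral_of_dominated_convergence
        (μ := volume) (a := 0) (b := t)
        (F := fun (n : ℕ) s => (t - s) ^ (-α) * (d n * s ^ ((n + 1) * α - 1)))
        (f := fun s => (t - s) ^ (-α) * deriv u s)
        (fun n s => C n * k s) (fun n => by fun_prop)
        (fun n => ae_of_all _ fun s hs => hbound n s (hIoc ▸ hs))
        (ae_of_all _ fun s _ => hC.mul_right (k s)) hbound_int
        (ae_of_all _ fun s hs => hlim s (hIoc ▸ hs))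
      have hterm : ∀ n : ℕ, ∫ s in (0 : ℝ)..t, (t - s) ^ (-α) * (d n * s ^ ((n + 1) * α - 1)) =
          Real.Gamma (1 - α) * -lam * ((-lam * t ^ α) ^ n / Real.Gamma (1 + n * α)) := by
        intro n
        have hn : (0 : ℝ) < (n + 1) * α := by positivity
        have hG := Real.Gamma_pos_of_pos hn
        have hbeta := integral_rpow_mul_sub_rpow hn (show 0 < 1 - α by linarith) ht
        rw [show ((n : ℝ) + 1) * α + (1 - α) = 1 + n * α by ring, add_sub_cancel_left,
          show 1 - α - 1 = -α by ring] at hbeta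
        calc _ = ∫ s in (0 : ℝ)..t, d n * (s ^ (((n : ℝ) + 1) * α - 1) * (t - s) ^ (-α)) := by
              congr 1 with s
              ring
          _ = _ := by
            rw [intervalIntegral.integral_const_mul, hbeta, mul_pow, ← Real.rpow_natCast (t ^ α),
              ← Real.rpow_mul ht.le, mul_comm α]
            simp only [d]
            field_simp
            ring
      simp_rw [hterm] at hint
      have hG := Real.Gamma_pos_of_pos (show 0 < 1 - α by linarith)
      rw [← hint.tsum_eq, tsum_mul_left, hu]
      field_simp
  · simp only [hu, Real.zero_rpow hα0.ne', mul_zero]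
    rw [tsum_eq_single 0 fun n hn => by simp [hn]]
    simp
end

section
/- Let n, m ∈ ℕ with 1 ≤ n < m and set α = n/m. Let μ₁, μ₂ ∈ ℝ, θ₁, θ₂ ∈ (−π, π), and a, b, c ∈ ℂ. For j = 1,2 and s ∈ ℂ \ {μ_j}, define the branch power P_j(s) = exp(α · (Log(e^{−iθ_j}(s − μ_j)) + iθ_j)), where Log is the principal complex logarithm; P_j is the power (s−μ_j)^α taken with branch cut along the ray arg(s−μ_j) = π + θ_j. Then the set { s ∈ ℂ \ {μ₁, μ₂} : (P₁(s) + a)(P₂(s) + b) = c } is finite. -/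
open Polynomial in
/-- The resultant of a monic bivariate polynomial with another one, evaluated at `s`, vanishes
exactly when the two specializations at `s` have a common root. -/
theorem Polynomial.eval_resultant_eq_zero_iff {K : Type*} [Field K] [IsAlgClosed K]
    {F : K[X][X]} (hF : F.Monic) (G : K[X][X]) (s : K) :
    (F.resultant G).eval s = 0 ↔
      ∃ x, (F.map (evalRingHom s)).eval x = 0 ∧ (G.map (evalRingHom s)).eval x = 0 := by
  have hFs : (F.map (evalRingHom s)).Monic := hF.map _
  rw [← coe_evalRingHom, ← resultant_map_map, ← hF.natDegree_map (evalRingHom s),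
    resultant_eq_prod_eval _ _ _ natDegree_map_le (IsAlgClosed.splits _), hFs.leadingCoeff,
    one_pow, one_mul, Multiset.prod_eq_zero_iff, Multiset.mem_map]
  simp only [mem_roots hFs.ne_zero, IsRoot.def]

/-- If `x` and `y` are large compared to `a`, `b`, `c`, then `(x + a) * (y + b) = c` fails, also
after multiplying `y` by an `m`-th root of unity. Here `w` stands for `y ^ m`. -/
theorem add_pow_mul_ne_of_large {m : ℕ} {a b c x w : ℂ} {K : ℝ}
    (hK : K = ‖a‖ + ‖b‖ + ‖c‖ + 1) (hm : m ≠ 0) (hx : K ^ m ≤ ‖x ^ m‖) (hw : K ^ m ≤ ‖w‖) :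
    (x + a) ^ m * w ≠ (c - b * (x + a)) ^ m := by
  intro h
  have ha := norm_nonneg a
  have hb := norm_nonneg b
  have hc := norm_nonneg c
  have hK0 : 0 ≤ K := by rw [hK]; positivity
  have hxK : K ≤ ‖x‖ := by
    rw [norm_pow] at hx
    exact le_of_pow_le_pow_left₀ hm (norm_nonneg x) hx
  have hu : ‖b‖ + ‖c‖ + 1 ≤ ‖x + a‖ := by
    have := norm_sub_le (x + a) a
    rw [add_sub_cancel_right] at this
    linarith
  have hle : ‖x + a‖ * K ≤ ‖c - b * (x + a)‖ := by
    refine le_of_pow_le_pow_left₀ hm (norm_nonneg _) ?_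
    rw [← norm_pow (c - b * (x + a)), ← h, norm_mul, norm_pow, mul_pow]
    gcongr
  have hsub := norm_sub_le c (b * (x + a))
  rw [norm_mul] at hsub
  rw [hK] at hle
  nlinarith [mul_nonneg ha (norm_nonneg (x + a)),
    mul_le_mul_of_nonneg_left (show (1 : ℝ) ≤ ‖x + a‖ by linarith) hc]

open Polynomial in
/-- The relation `(x + a) * (y + b) = c` with `x ^ m = (s - μ₁) ^ n` and `y ^ m = (s - μ₂) ^ n`,
for any choice of the `m`-th roots `x` and `y`, has only finitely many solutions `s`. -/
theorem finite_setOf_exists_roots_mul_eq {n m : ℕ} (hn : n ≠ 0) (hm : m ≠ 0)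
    (μ₁ μ₂ a b c : ℂ) :
    {s : ℂ | ∃ x y : ℂ, x ^ m = (s - μ₁) ^ n ∧ y ^ m = (s - μ₂) ^ n ∧
      (x + a) * (y + b) = c}.Finite := by
  let F : ℂ[X][X] := X ^ m - C ((X - C μ₁) ^ n)
  let G : ℂ[X][X] := (X + C (C a)) ^ m * C ((X - C μ₂) ^ n) -
    (C (C c) - C (C b) * (X + C (C a))) ^ m
  have hF : F.Monic := monic_X_pow_sub_C _ hm
  have hiff (s : ℂ) : (F.resultant G).eval s = 0 ↔ ∃ x : ℂ, x ^ m = (s - μ₁) ^ n ∧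
      (x + a) ^ m * (s - μ₂) ^ n = (c - b * (x + a)) ^ m := by
    rw [eval_resultant_eq_zero_iff hF]
    simp [F, G, sub_eq_zero]
  have hne : F.resultant G ≠ 0 := by
    intro h0
    obtain ⟨K, hK⟩ : ∃ K : ℝ, K = ‖a‖ + ‖b‖ + ‖c‖ + 1 := ⟨_, rfl⟩
    have hK1 : 1 ≤ K := by rw [hK]; linarith [norm_nonneg a, norm_nonneg b, norm_nonneg c]
    obtain ⟨s, hs⟩ : ∃ s : ℂ, ‖s‖ = ‖μ₁‖ + ‖μ₂‖ + K ^ m :=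
      ⟨((‖μ₁‖ + ‖μ₂‖ + K ^ m : ℝ) : ℂ), by
        rw [Complex.norm_real, Real.norm_of_nonneg (by positivity)]⟩
    have hlarge (μ : ℂ) (hμ : ‖μ‖ ≤ ‖μ₁‖ + ‖μ₂‖) : K ^ m ≤ ‖(s - μ) ^ n‖ := by
      have h1 : K ^ m ≤ ‖s - μ‖ := by linarith [norm_sub_norm_le s μ]
      rw [norm_pow]
      exact h1.trans (le_self_pow₀ ((one_le_pow₀ hK1).trans h1) hn)
    obtain ⟨x, hx, hxw⟩ := (hiff s).1 (by rw [h0, eval_zero])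
    refine add_pow_mul_ne_of_large hK hm ?_ (hlarge μ₂ ?_) hxw
    · rw [hx]
      exact hlarge μ₁ (le_add_of_nonneg_right (norm_nonneg _))
    · exact le_add_of_nonneg_left (norm_nonneg _)
  refine (finite_setOfPred_isRoot hne).subset ?_
  rintro s ⟨x, y, hx, hy, h⟩
  refine (hiff s).2 ⟨x, hx, ?_⟩
  rw [← hy, ← mul_pow]
  congr 1
  linear_combination h

/-- The `m`-th power of a branch of `z ^ (n / m)` is `z ^ n`. -/
theorem exp_mul_log_add_pow {n m : ℕ} (hm : m ≠ 0) {α : ℝ} (hα : α = (n : ℝ) / (m : ℝ))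
    (θ : ℝ) {z : ℂ} (hz : z ≠ 0) :
    Complex.exp ((α : ℂ) * (Complex.log (Complex.exp (-Complex.I * (θ : ℂ)) * z)
      + Complex.I * (θ : ℂ))) ^ m = z ^ n := by
  have hmα : (m : ℂ) * (α : ℂ) = n := by
    rw [hα]
    push_cast
    field_simp
  rw [← Complex.exp_nat_mul, ← mul_assoc, hmα, Complex.exp_nat_mul, Complex.exp_add,
    Complex.exp_log (mul_ne_zero (Complex.exp_ne_zero _) hz), mul_right_comm, ← Complex.exp_add]
  simp


/-- For rational `α = n/m ∈ (0,1)`, the nontrivial factor of the dispersion relation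
of the subdiffusion model with linear creation/annihilation has finitely many roots:
the set `{s : (P₁(s)+a)(P₂(s)+b) = c}` is finite, where `P_j(s) = (s-μ_j)^α` is
taken with branch cut along the ray `arg(s-μ_j) = π + θ_j`. -/
theorem dispersion_relation_finite_roots
    (n m : ℕ) (hn : 1 ≤ n) (hnm : n < m) (α : ℝ) (hα : α = (n : ℝ) / (m : ℝ))
    (μ₁ μ₂ : ℝ) (θ₁ θ₂ : ℝ)
    (hθ₁ : θ₁ ∈ Set.Ioo (-Real.pi) Real.pi) (hθ₂ : θ₂ ∈ Set.Ioo (-Real.pi) Real.pi)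
    (a b c : ℂ)
    (P₁ P₂ : ℂ → ℂ)
    (hP₁ : ∀ s : ℂ, s ≠ (μ₁ : ℂ) →
      P₁ s = Complex.exp ((α : ℂ) *
        (Complex.log (Complex.exp (-Complex.I * (θ₁ : ℂ)) * (s - (μ₁ : ℂ)))
          + Complex.I * (θ₁ : ℂ))))
    (hP₂ : ∀ s : ℂ, s ≠ (μ₂ : ℂ) →
      P₂ s = Complex.exp ((α : ℂ) *
        (Complex.log (Complex.exp (-Complex.I * (θ₂ : ℂ)) * (s - (μ₂ : ℂ)))
          + Complex.I * (θ₂ : ℂ)))) :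
    Set.Finite {s : ℂ | s ≠ (μ₁ : ℂ) ∧ s ≠ (μ₂ : ℂ) ∧
      (P₁ s + a) * (P₂ s + b) = c} := by
  have hm : m ≠ 0 := by omega
  refine (finite_setOf_exists_roots_mul_eq (n := n) (by omega) hm μ₁ μ₂ a b c).subset ?_
  rintro s ⟨h₁, h₂, h⟩
  refine ⟨P₁ s, P₂ s, ?_, ?_, h⟩
  · rw [hP₁ s h₁, exp_mul_log_add_pow hm hα θ₁ (sub_ne_zero.2 h₁)]
  · rw [hP₂ s h₂, exp_mul_log_add_pow hm hα θ₂ (sub_ne_zero.2 h₂)]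
end

section
/- Let γ > 0 and d > 0, and define g(k) = k^{γ/2} · √( d(1 − k^γ)/(1 + k^γ) ) for k > 0 with k^γ < 1. Then g(k) ≤ √( d(3 − 2√2) ) for all such k, with equality if and only if k = (√2 − 1)^{1/γ}. In particular, the critical Turing parameter of the fractional Schnakenberg system is p_c = √( d(3 − √8) ), which is independent of the fractional order γ, while the critical wavenumber is k_c(γ) = (√(√2 − 1))^{2/γ}, which depends on γ. -/
/-- The maximum of `x(1-x)/(1+x)` in completed-square form. -/
lemma mul_one_sub_div_one_add_eq {x : ℝ} (hx : 0 < x) (d : ℝ) :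
    x * (d * (1 - x) / (1 + x)) =
      d * (3 - 2 * Real.sqrt 2) - d * (x - (Real.sqrt 2 - 1)) ^ 2 / (1 + x) := by
  have hs : Real.sqrt 2 ^ 2 = 2 := Real.sq_sqrt (by norm_num)
  have hx1 : 1 + x ≠ 0 := by positivity
  field_simp
  linear_combination d * hs

lemma rpow_half_mul_sqrt {k : ℝ} (hk : 0 < k) (γ y : ℝ) :
    k ^ (γ / 2) * Real.sqrt y = Real.sqrt (k ^ γ * y) := by
  rw [Real.sqrt_mul (Real.rpow_nonneg hk.le _), Real.sqrt_eq_rpow (k ^ γ),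
    ← Real.rpow_mul hk.le, mul_one_div]

/-- Turing threshold for the fractional Schnakenberg system: the bifurcation value
`g(k) = k^{γ/2} √(d(1-k^γ)/(1+k^γ))` satisfies `g(k) ≤ √(d(3-2√2))` for all
admissible `k`, with equality iff `k = (√2-1)^{1/γ}`. In particular the critical
parameter `p_c = √(d(3-√8))` is independent of `γ`, while the critical wavenumber
`k_c(γ) = (√(√2-1))^{2/γ}` depends on `γ`. -/
theorem schnakenberg_turing_threshold
    (γ d : ℝ) (hγ : 0 < γ) (hd : 0 < d) :
    (∀ k : ℝ, 0 < k → k ^ γ < 1 →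
      (k ^ (γ / 2) * Real.sqrt (d * (1 - k ^ γ) / (1 + k ^ γ))
          ≤ Real.sqrt (d * (3 - 2 * Real.sqrt 2)) ∧
        (k ^ (γ / 2) * Real.sqrt (d * (1 - k ^ γ) / (1 + k ^ γ))
            = Real.sqrt (d * (3 - 2 * Real.sqrt 2)) ↔
          k = (Real.sqrt 2 - 1) ^ ((1 : ℝ) / γ)))) ∧
    Real.sqrt (d * (3 - 2 * Real.sqrt 2)) = Real.sqrt (d * (3 - Real.sqrt 8)) ∧
    (Real.sqrt 2 - 1) ^ ((1 : ℝ) / γ) = Real.sqrt (Real.sqrt 2 - 1) ^ (2 / γ) := by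
  have hs : Real.sqrt 2 ^ 2 = 2 := Real.sq_sqrt (by norm_num)
  have hs1 : 0 < Real.sqrt 2 - 1 := by
    have := Real.one_lt_sqrt_two
    linarith
  refine ⟨fun k hk hk1 => ?_, ?_, ?_⟩
  · have hx : 0 < k ^ γ := Real.rpow_pos_of_pos hk γ
    have hx1 : 0 < 1 - k ^ γ := by linarith
    have hlhs : 0 ≤ k ^ γ * (d * (1 - k ^ γ) / (1 + k ^ γ)) := by positivity
    have hrhs : 0 ≤ d * (3 - 2 * Real.sqrt 2) := by
      have : 3 - 2 * Real.sqrt 2 = (Real.sqrt 2 - 1) ^ 2 := by linear_combination -hs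
      rw [this]
      positivity
    have key := mul_one_sub_div_one_add_eq hx d
    rw [rpow_half_mul_sqrt hk]
    constructor
    · apply Real.sqrt_le_sqrt
      rw [key]
      have : 0 ≤ d * (k ^ γ - (Real.sqrt 2 - 1)) ^ 2 / (1 + k ^ γ) := by positivity
      linarith
    · rw [Real.sqrt_inj hlhs hrhs, key, sub_eq_self, one_div,
        Real.eq_rpow_inv hk.le hs1.le hγ.ne', div_eq_zero_iff, mul_eq_zero,
        or_iff_left (by positivity : 1 + k ^ γ ≠ 0), or_iff_right hd.ne',
        sq_eq_zero_iff, sub_eq_zero]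
  · have : Real.sqrt 8 = 2 * Real.sqrt 2 := by
      rw [show (8 : ℝ) = 2 ^ 2 * 2 by norm_num, Real.sqrt_mul (by norm_num),
        Real.sqrt_sq (by norm_num)]
    rw [this]
  · rw [Real.sqrt_eq_rpow (Real.sqrt 2 - 1), ← Real.rpow_mul hs1.le]
    congr 1
    ring
end
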